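/- Let λ = (1 − β f′(b))/n and define, for σ ∈ Ω_n, D₁(σ) = (1/n) ∑_{i=1}^n ∫_{S^{N−1}} (W_n(σ) − W_n(σ^{i,τ})) g_{σ,i}(τ) dμ(τ). Then there exists a constant C > 0, depending only on β and N, such that for every n ≥ 1 the random variable R := D₁/λ − W_n satisfies E_{P_{n,β}}|R| ≤ C n^{−1/2}. Equivalently, the conditional expectation of W_n − W_n′ given σ equals λ(W_n + R) with E|R| ≤ C n^{−1/2}. -/

import Mathlib

open MeasureTheory Real RealInnerProductSpace

noncomputable section

def besselRatio (N : ℕ) (x : ℝ) : ℝ :=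
  x / ((N : ℝ) - 1) *
      (∫ θ in (0:ℝ)..π, Real.exp (x * Real.cos θ) * Real.sin θ ^ N) /
    ∫ θ in (0:ℝ)..π, Real.exp (x * Real.cos θ) * Real.sin θ ^ (N - 2)

/-- The unit sphere `S^{N-1}` in `ℝ^N`. -/
abbrev UnitSphere (N : ℕ) := Metric.sphere (0 : EuclideanSpace ℝ (Fin N)) 1

/-- The map on the unit sphere induced by a linear isometry of `ℝ^N`. -/
def sphereMap {N : ℕ}
    (e : EuclideanSpace ℝ (Fin N) ≃ₗᵢ[ℝ] EuclideanSpace ℝ (Fin N))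
    (θ : UnitSphere N) : UnitSphere N :=
  ⟨e θ, by
    rw [mem_sphere_zero_iff_norm, e.norm_map]
    exact mem_sphere_zero_iff_norm.mp θ.2⟩

/-- Total spin `S_n(σ) = ∑ i, σ_i`. -/
def totalSpin {N n : ℕ} (σ : Fin n → UnitSphere N) : EuclideanSpace ℝ (Fin N) :=
  ∑ i, (σ i : EuclideanSpace ℝ (Fin N))

/-- `W_n(σ) = √n (β²/(n²b²) |S_n(σ)|² - 1)`. -/
def Wspin (N n : ℕ) (β b : ℝ) (σ : Fin n → UnitSphere N) : ℝ :=
  Real.sqrt n * (β ^ 2 / ((n : ℝ) ^ 2 * b ^ 2) * ‖totalSpin σ‖ ^ 2 - 1)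

/-- The (unnormalized) Gibbs weight `exp((β/(2n)) ∑_i ∑_j ⟨σ_i, σ_j⟩)`. -/
def gibbsWeight (N n : ℕ) (β : ℝ) (σ : Fin n → UnitSphere N) : ℝ :=
  Real.exp (β / (2 * n) * ∑ i, ∑ j,
    ⟪(σ i : EuclideanSpace ℝ (Fin N)), (σ j : EuclideanSpace ℝ (Fin N))⟫)

/-- The Gibbs measure `P_{n,β}` on `(S^{N-1})^n`. -/
def gibbsMeasure (N n : ℕ) (β : ℝ) (μ : Measure (UnitSphere N))
    [IsProbabilityMeasure μ] : Measure (Fin n → UnitSphere N) :=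
  (Measure.pi fun _ : Fin n => μ).withDensity fun σ =>
    ENNReal.ofReal
      (gibbsWeight N n β σ / ∫ τ, gibbsWeight N n β τ ∂(Measure.pi fun _ : Fin n => μ))

end
noncomputable section

/-- The conditional density under the Gibbs measure of the `i`-th spin given the others:
`g_{σ,i}(τ) = exp((β/n)⟨τ, S_n(σ) - σ_i⟩) / Z_{σ,i}`. -/
def condDens (N n : ℕ) (β : ℝ) (μ : Measure (UnitSphere N))
    (σ : Fin n → UnitSphere N) (i : Fin n) (τ : UnitSphere N) : ℝ :=
  Real.exp (β / n *
      ⟪(τ : EuclideanSpace ℝ (Fin N)), totalSpin σ - (σ i : EuclideanSpace ℝ (Fin N))⟫) /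
    ∫ τ', Real.exp (β / n *
      ⟪(τ' : EuclideanSpace ℝ (Fin N)), totalSpin σ - (σ i : EuclideanSpace ℝ (Fin N))⟫) ∂μ

/-- `D₁(σ) = (1/n) ∑ᵢ ∫ (W_n(σ) - W_n(σ^{i,τ})) g_{σ,i}(τ) dμ(τ)`, the conditional
expectation of `W_n - W_n'` given `σ` for the exchangeable pair obtained by resampling a
uniformly chosen coordinate. -/
def D1 (N n : ℕ) (β b : ℝ) (μ : Measure (UnitSphere N))
    (σ : Fin n → UnitSphere N) : ℝ :=
  (1 / (n : ℝ)) * ∑ i, ∫ τ,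
    (Wspin N n β b σ - Wspin N n β b (Function.update σ i τ)) * condDens N n β μ σ i τ ∂μ

structure GoodL (N : ℕ) (L : ℕ → ℝ → ℝ) : Prop where
  pos : ∀ x, 0 < L 0 x
  d : ∀ k x, HasDerivAt (L k) (L (k+1) x) x
  bd : ∀ k x, |L k x| ≤ L 0 x
  ode : ∀ x, 0 ≤ x → ((N:ℝ) - 1) * L 1 x = x * (L 0 x - L 2 x)

def rat (L : ℕ → ℝ → ℝ) (x : ℝ) : ℝ := L 1 x / L 0 x
def rat' (L : ℕ → ℝ → ℝ) (x : ℝ) : ℝ := L 2 x / L 0 x - (L 1 x / L 0 x)^2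

namespace GoodL
variable {N : ℕ} {L : ℕ → ℝ → ℝ}

lemma q_bd (h : GoodL N L) (k : ℕ) (x : ℝ) : |L k x / L 0 x| ≤ 1 := by
  rw [abs_div, abs_of_pos (h.pos x)]
  exact (div_le_one (h.pos x)).2 (h.bd k x)

lemma q_d (h : GoodL N L) (k : ℕ) (x : ℝ) :
    HasDerivAt (fun x => L k x / L 0 x)
      (L (k+1) x / L 0 x - (L k x / L 0 x) * (L 1 x / L 0 x)) x := by
  have := (h.d k x).div (h.d 0 x) (h.pos x).ne'
  refine this.congr_deriv ?_
  have := (h.pos x).ne'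
  field_simp

lemma rat_d (h : GoodL N L) (x : ℝ) : HasDerivAt (rat L) (rat' L x) x := by
  have := h.q_d 1 x
  refine this.congr_deriv ?_
  simp [rat']; ring

lemma rat_bd (h : GoodL N L) (x : ℝ) : |rat L x| ≤ 1 := h.q_bd 1 x

lemma rat'_bd (h : GoodL N L) (x : ℝ) : |rat' L x| ≤ 2 := by
  have h1 := h.q_bd 1 x
  have h2 := h.q_bd 2 x
  unfold rat'
  rw [abs_le] at *
  constructor <;> nlinarith

lemma rat'_d (h : GoodL N L) (x : ℝ) : ∃ d, |d| ≤ 6 ∧ HasDerivAt (rat' L) d x := by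
  have a := (h.q_d 2 x).sub ((h.rat_d x).pow 2)
  refine ⟨_, ?_, a⟩
  have h1 := h.q_bd 1 x
  have h2 := h.q_bd 2 x
  have h3 := h.q_bd 3 x
  have h4 := h.rat_bd x
  have h5 := h.rat'_bd x
  have e1 : |(L 2 x / L 0 x) * (L 1 x / L 0 x)| ≤ 1 := by
    rw [abs_mul]; nlinarith [abs_nonneg (L 2 x / L 0 x), abs_nonneg (L 1 x / L 0 x)]
  have e2 : |rat L x * rat' L x| ≤ 2 := by
    rw [abs_mul]; nlinarith [abs_nonneg (rat L x), abs_nonneg (rat' L x)]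
  simp only [Nat.reduceAdd] at *
  norm_num
  rw [abs_le] at *
  constructor <;> nlinarith

lemma rat_lip (h : GoodL N L) (x y : ℝ) : |rat L x - rat L y| ≤ 2 * |x - y| := by
  have := convex_univ.norm_image_sub_le_of_norm_hasDerivWithin_le (f := rat L) (f' := rat' L)
    (C := 2) (s := Set.univ) (x := y) (y := x)
    (fun x _ => (h.rat_d x).hasDerivWithinAt) (fun x _ => h.rat'_bd x) trivial trivial
  simpa using this

lemma rat'_lip (h : GoodL N L) (x y : ℝ) : |rat' L x - rat' L y| ≤ 6 * |x - y| := by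
  choose d hd1 hd2 using h.rat'_d
  have := convex_univ.norm_image_sub_le_of_norm_hasDerivWithin_le (f := rat' L) (f' := d)
    (C := 6) (s := Set.univ) (x := y) (y := x)
    (fun x _ => (hd2 x).hasDerivWithinAt) (fun x _ => hd1 x) trivial trivial
  simpa using this

lemma rat_taylor (h : GoodL N L) (x b : ℝ) :
    |rat L x - rat L b - rat' L b * (x - b)| ≤ 6 * (x - b)^2 := by
  have := (convex_uIcc b x).norm_image_sub_le_of_norm_hasDerivWithin_le
    (f := fun y => rat L y - rat' L b * y) (f' := fun y => rat' L y - rat' L b * 1)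
    (C := 6 * |x - b|) (s := Set.uIcc b x) (x := b) (y := x)
    (fun y _ => ((h.rat_d y).sub ((hasDerivAt_id y).const_mul _)).hasDerivWithinAt) ?_
    Set.left_mem_uIcc Set.right_mem_uIcc
  · simp only [Real.norm_eq_abs] at this
    calc _ = |rat L x - rat' L b * x - (rat L b - rat' L b * b)| := by congr 1; ring
      _ ≤ _ := this
      _ = _ := by rw [mul_assoc, ← sq, sq_abs]
  · intro y hy
    rw [mul_one, Real.norm_eq_abs]
    refine (h.rat'_lip y b).trans ?_
    have := Set.abs_sub_left_of_mem_uIcc hy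
    gcongr

lemma L1_zero (h : GoodL N L) (hN : 2 ≤ N) : L 1 0 = 0 := by
  have := h.ode 0 le_rfl
  have h2 : (2:ℝ) ≤ N := by exact_mod_cast hN
  rw [zero_mul] at this
  rcases mul_eq_zero.1 this with h | h
  · linarith
  · exact h

lemma cont (h : GoodL N L) (k : ℕ) : Continuous (L k) :=
  continuous_iff_continuousAt.2 fun x => (h.d k x).continuousAt

lemma L1_pos (h : GoodL N L) (hN : 2 ≤ N) {x : ℝ} (hx : 0 < x) : 0 < L 1 x := by
  obtain ⟨M, rfl⟩ : ∃ M, N = M + 2 := ⟨N - 2, by omega⟩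
  have key : StrictMonoOn (fun x => x^(M+1) * L 1 x) (Set.Ici 0) := by
    apply strictMonoOn_of_deriv_pos (convex_Ici 0)
    · exact ((continuous_pow _).mul (h.cont 1)).continuousOn
    · intro y hy
      rw [interior_Ici] at hy
      have hy : 0 < y := hy
      refine lt_of_lt_of_eq ?_ ((hasDerivAt_pow (M+1) y).mul (h.d 1 y)).deriv.symm
      have := h.ode y hy.le
      push_cast at this ⊢
      have e : ((M:ℝ) + 1) * y ^ M * L 1 y + y ^ (M + 1) * L 2 y
        = y^(M+1) * L 0 y := by
        rw [pow_succ]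
        linear_combination y^M * this
      rw [e]
      have := h.pos y
      positivity
  have := key Set.self_mem_Ici hx.le hx
  simp at this
  exact (pos_iff_pos_of_mul_pos this).1 (by positivity)

/-- strict sublinearity of the ratio -/
lemma key_ineq (h : GoodL N L) (hN : 2 ≤ N) {x : ℝ} (hx : 0 < x) :
    0 < rat L x - x * rat' L x := by
  obtain ⟨M, rfl⟩ : ∃ M, N = M + 2 := ⟨N - 2, by omega⟩
  have key : StrictMonoOn
      (fun x => x^(M+1) * (((M:ℝ)+2) * (L 0 x * L 1 x) - x * (L 0 x)^2 + x * (L 1 x)^2))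
      (Set.Ici 0) := by
    apply strictMonoOn_of_deriv_pos (convex_Ici 0)
    · have := h.cont 0
      have := h.cont 1
      fun_prop
    · intro y hy
      rw [interior_Ici] at hy
      have hy : 0 < y := hy
      have d := (hasDerivAt_pow (M+1) y).mul
        (((((h.d 0 y).mul (h.d 1 y)).const_mul ((M:ℝ)+2)).sub
          ((hasDerivAt_id y).mul ((h.d 0 y).pow 2))).add
          ((hasDerivAt_id y).mul ((h.d 1 y).pow 2)))
      have d' := d.deriv
      simp only [id] at d'
      refine lt_of_lt_of_eq ?_ d'.symm
      push_cast
      have e := h.L1_pos hN hy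
      have : 0 < 2 * y^(M+1) * (L 1 y)^2 := by positivity
      refine lt_of_lt_of_eq this ?_
      simp
      simp only [pow_succ]
      have o := h.ode y hy.le
      push_cast at o
      linear_combination (-y^M * ((M+2) * L 0 y + 2 * y * L 1 y)) * o
  have := key Set.self_mem_Ici hx.le hx
  simp at this
  have h3 := (pos_iff_pos_of_mul_pos this).1 (by positivity)
  have o := h.ode x hx.le
  have p := h.pos x
  push_cast at o
  unfold rat rat'
  have : L 1 x / L 0 x - x * (L 2 x / L 0 x - (L 1 x / L 0 x)^2) =
    (((M:ℝ)+2) * (L 0 x * L 1 x) - x * (L 0 x)^2 + x * (L 1 x)^2) / (L 0 x)^2 := by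
    field_simp
    linear_combination (-L 0 x) * o
  rw [this]; positivity

lemma rat_div_d (h : GoodL N L) {x : ℝ} (hx : 0 < x) :
    HasDerivAt (fun x => rat L x / x) (- ((rat L x - x * rat' L x) / x^2)) x := by
  refine ((h.rat_d x).div (hasDerivAt_id x) hx.ne').congr_deriv ?_
  simp; ring

/-- sign of h -/
lemma q_lower (h : GoodL N L) (hN : 2 ≤ N) {β b ε : ℝ} (hβ : 0 < β) (hε : 0 < ε) (hεb : ε < b)
    (hbβ : b ≤ β) (hfix : b = β * rat L b) :
    ∃ c > 0, ∀ x, ε ≤ x → x ≤ β → c * (x - b)^2 ≤ x * (x - β * rat L x) * (x^2 - b^2) := by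
  have hc : ContinuousOn (fun x => (rat L x - x * rat' L x) / x^2) (Set.Icc ε β) := by
    have c1 : Continuous (rat L) := continuous_iff_continuousAt.2 fun x => (h.rat_d x).continuousAt
    have c2 : Continuous (rat' L) := continuous_iff_continuousAt.2 fun x => by
      obtain ⟨d, _, hd⟩ := h.rat'_d x; exact hd.continuousAt
    apply ContinuousOn.div (by fun_prop) (by fun_prop)
    intro x hx
    have : 0 < x := hε.trans_le hx.1
    positivity
  obtain ⟨x0, hx0, hmin⟩ := isCompact_Icc.exists_isMinOn ⟨ε, le_rfl, hεb.le.trans hbβ⟩ hc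
  set m := (rat L x0 - x0 * rat' L x0) / x0^2 with hm
  have hx0p : 0 < x0 := hε.trans_le hx0.1
  have mpos : 0 < m := div_pos (h.key_ineq hN hx0p) (by positivity)
  have hb : 0 < b := hε.trans hεb
  have hrb : rat L b / b = 1 / β := by
    rw [div_eq_div_iff hb.ne' hβ.ne']; linarith
  -- monotone
  have mono : AntitoneOn (fun x => rat L x / x + m * x) (Set.Icc ε β) := by
    apply antitoneOn_of_deriv_nonpos (convex_Icc _ _)
    · intro y hy
      exact ((h.rat_div_d (hε.trans_le hy.1)).add
        ((hasDerivAt_id y).const_mul m)).continuousAt.continuousWithinAt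
    · intro y hy
      rw [interior_Icc] at hy
      exact ((h.rat_div_d (hε.trans hy.1)).add
        ((hasDerivAt_id y).const_mul m)).differentiableAt.differentiableWithinAt
    · intro y hy
      rw [interior_Icc] at hy
      have d := ((h.rat_div_d (hε.trans hy.1)).add ((hasDerivAt_id y).const_mul m)).deriv
      simp only [id] at d
      refine le_of_eq_of_le d ?_
      have := hmin (Set.Ioo_subset_Icc_self hy)
      simp only [Set.mem_ofPred_eq] at this
      linarith
  refine ⟨β * m * ε^2 * b, by positivity, fun x hx1 hx2 => ?_⟩
  have hx : 0 < x := hε.trans_le hx1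
  -- (1 - β f/x) (x-b) ≥ β m (x-b)^2
  have A : β * m * (x-b)^2 ≤ (1 - β * (rat L x / x)) * (x - b) := by
    have hβ1 : β * (1/β) = 1 := by field_simp
    rcases le_total x b with hh | hh
    · have := mono ⟨hx1, hx2⟩ ⟨hεb.le, hbβ⟩ hh
      simp only [hrb] at this
      have : β * (1/β + m * b) ≤ β * (rat L x / x + m * x) := by gcongr
      nlinarith
    · have := mono ⟨hεb.le, hbβ⟩ ⟨hx1, hx2⟩ hh
      simp only [hrb] at this
      have : β * (rat L x / x + m * x) ≤ β * (1/β + m * b) := by gcongr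
      nlinarith
  have B : x * (x - β * rat L x) * (x^2 - b^2) =
      x^2 * (x + b) * ((1 - β * (rat L x / x)) * (x - b)) := by
    field_simp; ring
  rw [B]
  calc β * m * ε^2 * b * (x-b)^2 = ε^2 * b * (β * m * (x-b)^2) := by ring
    _ ≤ x^2 * (x + b) * (β * m * (x-b)^2) := by gcongr; linarith
    _ ≤ _ := by gcongr

lemma h_neg (h : GoodL N L) (hN : 2 ≤ N) {β b x : ℝ} (hβ : 0 < β) (hx : 0 < x) (hxb : x < b)
    (hfix : b = β * rat L b) : x < β * rat L x := by
  have hb := hx.trans hxb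
  have hrb : rat L b / b = 1 / β := by
    rw [div_eq_div_iff hb.ne' hβ.ne']; linarith
  have mono : StrictAntiOn (fun x => rat L x / x) (Set.Ioi 0) := by
    apply strictAntiOn_of_deriv_neg (convex_Ioi _)
    · intro y hy
      exact (h.rat_div_d hy).continuousAt.continuousWithinAt
    · intro y hy
      rw [interior_Ioi] at hy
      have hy : 0 < y := hy
      rw [(h.rat_div_d hy).deriv, neg_lt_zero]
      exact div_pos (h.key_ineq hN hy) (by positivity)
  have := mono hx hb hxb
  simp only [hrb] at this
  rw [div_lt_div_iff₀ hβ hx] at this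
  linarith

lemma h_nonneg_small (h : GoodL N L) (hN : 2 ≤ N) {β b x : ℝ} (hβ : 0 < β) (hx : 0 ≤ x)
    (hxb : x < b) (hfix : b = β * rat L b) : 0 ≤ x * (x - β * rat L x) * (x^2 - b^2) := by
  rcases hx.eq_or_lt with rfl | hx
  · simp
  · have := h.h_neg hN hβ hx hxb hfix
    have h2 : x^2 ≤ b^2 := by gcongr
    rw [mul_assoc]
    exact mul_nonneg hx.le (mul_nonneg_of_nonpos_of_nonpos (by linarith) (by linarith))

lemma hder_pos (h : GoodL N L) (hN : 2 ≤ N) {β b : ℝ} (hβ : 0 < β) (hb : 0 < b)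
    (hfix : b = β * rat L b) : 0 < 1 - β * rat' L b := by
  have := mul_pos hβ (h.key_ineq hN hb)
  have : 0 < b * (1 - β * rat' L b) := by nlinarith
  exact (pos_iff_pos_of_mul_pos this).1 hb

lemma rho_gt (h : GoodL N L) (hN : 2 ≤ N) {β b : ℝ} (hβ : 0 < β) (hb : 0 < b)
    (hfix : b = β * rat L b) (h0 : L 0 0 = 1) : 1 < L 0 b * exp (-(b^2/(2*β))) := by
  have dd : ∀ y, HasDerivAt (fun x => L 0 x * exp (-(x^2/(2*β))))
    (L 1 y * exp (-(y^2/(2*β))) + L 0 y * (exp (-(y^2/(2*β))) * (-(y/β)))) y := by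
    intro y
    have e : HasDerivAt (fun x : ℝ => -(x^2/(2*β))) (-(y/β)) y := by
      refine ((hasDerivAt_pow 2 y).div_const (2*β)).neg.congr_deriv ?_
      simp; field_simp
    exact (h.d 0 y).mul e.exp
  have key : StrictMonoOn (fun x => L 0 x * exp (-(x^2/(2*β)))) (Set.Icc 0 b) := by
    apply strictMonoOn_of_deriv_pos (convex_Icc 0 b)
    · intro y _; exact (dd y).continuousAt.continuousWithinAt
    · intro y hy
      rw [interior_Icc] at hy
      rw [(dd y).deriv]
      have h1 := h.h_neg hN hβ hy.1 hy.2 hfix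
      have p := h.pos y
      have : L 1 y = L 0 y * rat L y := by unfold rat; field_simp
      rw [this]
      have e : L 0 y * rat L y * exp (-(y^2/(2*β))) + L 0 y * (exp (-(y^2/(2*β))) * (-(y/β)))
        = L 0 y * exp (-(y^2/(2*β))) * ((β * rat L y - y) / β) := by field_simp; ring
      rw [e]
      have : 0 < β * rat L y - y := by linarith
      positivity
  have := key ⟨le_rfl, hb.le⟩ ⟨hb.le, le_rfl⟩ hb
  simpa [h0] using this

end GoodL

def mom {α : Type*} [MeasurableSpace α] (ρ : Measure α) (c w : α → ℝ) (k : ℕ) (x : ℝ) : ℝ :=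
  ∫ a, w a * c a ^ k * exp (x * c a) ∂ρ

section mom
variable {α : Type*} [MeasurableSpace α] {ρ : Measure α} [IsFiniteMeasure ρ] {c w : α → ℝ}

lemma mom_bound {K : ℝ} (hcb : ∀ a, |c a| ≤ 1) (hwb : ∀ a, |w a| ≤ K)
    (k : ℕ) (x : ℝ) (a : α) : ‖w a * c a ^ k * exp (x * c a)‖ ≤ K * exp |x| := by
  have hK : 0 ≤ K := (abs_nonneg _).trans (hwb a)
  rw [norm_mul, norm_mul, norm_pow, Real.norm_eq_abs, Real.norm_eq_abs, Real.norm_eq_abs, abs_exp]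
  have h1 : |c a|^k ≤ 1 := pow_le_one₀ (abs_nonneg _) (hcb a)
  have h2 : exp (x * c a) ≤ exp |x| := by
    apply exp_le_exp.2
    refine (le_abs_self _).trans ?_
    rw [abs_mul]
    exact mul_le_of_le_one_right (abs_nonneg _) (hcb a)
  calc |w a| * |c a|^k * exp (x * c a) ≤ K * 1 * exp |x| := by
        gcongr
        exact hwb a
    _ = _ := by ring

lemma mom_integrable (hc : Measurable c) (hw : Measurable w) {K : ℝ} (hcb : ∀ a, |c a| ≤ 1)
    (hwb : ∀ a, |w a| ≤ K) (k : ℕ) (x : ℝ) :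
    Integrable (fun a => w a * c a ^ k * exp (x * c a)) ρ := by
  refine Integrable.of_bound (C := K * exp |x|) (by fun_prop) ?_
  filter_upwards with a using mom_bound hcb hwb k x a

lemma mom_hasDerivAt (hc : Measurable c) (hw : Measurable w) {K : ℝ} (hcb : ∀ a, |c a| ≤ 1)
    (hwb : ∀ a, |w a| ≤ K) (k : ℕ) (x : ℝ) :
    HasDerivAt (mom ρ c w k) (mom ρ c w (k+1) x) x := by
  refine (hasDerivAt_integral_of_dominated_loc_of_deriv_le (s := Metric.ball x 1)
    (F := fun x a => w a * c a ^ k * exp (x * c a))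
    (F' := fun x a => w a * c a ^ (k+1) * exp (x * c a))
    (bound := fun _ => K * exp (|x|+1)) (Metric.ball_mem_nhds x one_pos)
    ?_ (mom_integrable hc hw hcb hwb k x) ?_ ?_ (integrable_const _) ?_).2
  · filter_upwards with y
    fun_prop
  · fun_prop
  · filter_upwards with a y hy
    refine (mom_bound hcb hwb (k+1) y a).trans ?_
    have hK : 0 ≤ K := (abs_nonneg _).trans (hwb a)
    have : |y| ≤ |x| + 1 := by
      rw [Metric.mem_ball, Real.dist_eq] at hy
      have := abs_sub_abs_le_abs_sub y x
      linarith
    gcongr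
  · filter_upwards with a y _
    have e : HasDerivAt (fun y : ℝ => y * c a) (c a) y := by
      simpa using (hasDerivAt_id y).mul_const (c a)
    refine (e.exp.const_mul (w a * c a ^ k)).congr_deriv ?_
    ring

end mom

section sphere
variable {N : ℕ} {μ : Measure (UnitSphere N)} [IsProbabilityMeasure μ]

lemma sphere_inner_le (u : EuclideanSpace ℝ (Fin N)) (τ : UnitSphere N) :
    |⟪(τ : EuclideanSpace ℝ (Fin N)), u⟫| ≤ ‖u‖ := by
  have := abs_real_inner_le_norm (τ : EuclideanSpace ℝ (Fin N)) u
  rwa [mem_sphere_zero_iff_norm.1 τ.2, one_mul] at this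

lemma inv_integral
    (hμinv : ∀ e : EuclideanSpace ℝ (Fin N) ≃ₗᵢ[ℝ] EuclideanSpace ℝ (Fin N),
      Measure.map (sphereMap e) μ = μ) {u v : EuclideanSpace ℝ (Fin N)} (huv : ‖u‖ = ‖v‖)
    {G : ℝ → ℝ} (hG : Continuous G) :
    ∫ τ, G ⟪(τ : EuclideanSpace ℝ (Fin N)), u⟫ ∂μ
      = ∫ τ, G ⟪(τ : EuclideanSpace ℝ (Fin N)), v⟫ ∂μ := by
  let e := (Submodule.span ℝ {u - v})ᗮ.reflection
  have he : e u = v := Submodule.reflection_sub huv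
  have hcont : Continuous (sphereMap e) := by
    apply Continuous.subtype_mk
    exact e.continuous.comp continuous_subtype_val
  conv_rhs => rw [← hμinv e]
  rw [integral_map hcont.measurable.aemeasurable]
  · congr 1; ext τ
    rw [← he]
    simp only [sphereMap]
    rw [e.inner_map_map]
  · exact (hG.comp (continuous_subtype_val.inner continuous_const)).aestronglyMeasurable

/-- sphere Laplace functions in direction u -/
abbrev sL (μ : Measure (UnitSphere N)) (u : EuclideanSpace ℝ (Fin N)) (k : ℕ) (x : ℝ) : ℝ :=
  mom μ (fun τ => ⟪(τ : EuclideanSpace ℝ (Fin N)), u⟫) (fun _ => 1) k x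

lemma inner_meas (u : EuclideanSpace ℝ (Fin N)) :
    Measurable (fun τ : UnitSphere N => ⟪(τ : EuclideanSpace ℝ (Fin N)), u⟫) :=
  (continuous_subtype_val.inner continuous_const).measurable

/-- Mixed second moment: by radial symmetry. -/
lemma mixed_moment
    (hμinv : ∀ e : EuclideanSpace ℝ (Fin N) ≃ₗᵢ[ℝ] EuclideanSpace ℝ (Fin N),
      Measure.map (sphereMap e) μ = μ) {u v : EuclideanSpace ℝ (Fin N)} (hu : ‖u‖ = 1)
    (hv : ‖v‖ = 1) (huv : ⟪u, v⟫ = 0) {x : ℝ} (hx : 0 < x) :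
    ∫ τ, exp (x * ⟪(τ : EuclideanSpace ℝ (Fin N)), u⟫) *
      ⟪(τ : EuclideanSpace ℝ (Fin N)), v⟫^2 ∂μ = sL μ u 1 x / x := by
  set c : UnitSphere N → ℝ := fun τ => ⟪(τ : EuclideanSpace ℝ (Fin N)), v⟫ with hc
  set w : UnitSphere N → ℝ := fun τ => exp (x * ⟪(τ : EuclideanSpace ℝ (Fin N)), u⟫) with hw
  have mc : Measurable c := inner_meas v
  have mw : Measurable w := ((inner_meas u).const_mul x).exp
  have hcb : ∀ a, |c a| ≤ 1 := fun a => (sphere_inner_le v a).trans hv.le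
  have hub : ∀ a : UnitSphere N, |⟪(a : EuclideanSpace ℝ (Fin N)), u⟫| ≤ 1 :=
    fun a => (sphere_inner_le u a).trans hu.le
  have hwb : ∀ a, |w a| ≤ exp |x| := fun a => by
    simp only [hw, abs_exp]
    apply exp_le_exp.2
    refine (le_abs_self _).trans ?_
    rw [abs_mul]
    exact mul_le_of_le_one_right (abs_nonneg _) (hub a)
  have rad : ∀ t, mom μ c w 0 t = sL μ u 0 (√(x^2+t^2)) := by
    intro t
    have h1 : ‖x • u + t • v‖ = ‖(√(x^2+t^2)) • u‖ := by
      rw [norm_smul, hu, mul_one, Real.norm_of_nonneg (sqrt_nonneg _)]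
      rw [← sqrt_sq (norm_nonneg _)]
      congr 1
      rw [norm_add_sq_real, norm_smul, norm_smul, hu, hv, inner_smul_left, inner_smul_right, huv]
      simp
    have := inv_integral hμinv h1 continuous_exp
    simp only [inner_add_right, inner_smul_right, exp_add] at this
    simpa [mom, hw, hc, sL] using this
  have hs : ∀ t, HasDerivAt (fun t => √(x^2+t^2)) (t / √(x^2+t^2)) t := by
    intro t
    have p : x^2+t^2 ≠ 0 := by positivity
    have := (((hasDerivAt_pow 2 t).const_add (x^2)).sqrt p)
    refine this.congr_deriv ?_
    have : √(x^2+t^2) ≠ 0 := by positivity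
    simp; field_simp
  have dL : ∀ k y, HasDerivAt (sL μ u k) (sL μ u (k+1) y) y := fun k y =>
    mom_hasDerivAt (inner_meas u) measurable_const hub (K := 1) (by simp) k y
  have first : ∀ t, mom μ c w 1 t = t * (sL μ u 1 (√(x^2+t^2)) / √(x^2+t^2)) := by
    intro t
    have d1 := mom_hasDerivAt (ρ := μ) mc mw hcb hwb 0 t
    have d2 := (dL 0 (√(x^2+t^2))).comp t (hs t)
    have : mom μ c w 0 = sL μ u 0 ∘ (fun t => √(x^2+t^2)) := funext rad
    rw [this] at d1
    rw [d1.unique d2]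
    ring
  have d1 := mom_hasDerivAt (ρ := μ) mc mw hcb hwb 1 0
  have hs0 : √(x^2+0^2) = x := by simp [sqrt_sq hx.le]
  have d2 := (hasDerivAt_id (0:ℝ)).mul (((dL 1 (√(x^2+0^2))).comp 0 (hs 0)).div (hs 0)
    (by rw [hs0]; exact hx.ne'))
  have e : mom μ c w 1 = id * ((sL μ u 1 ∘ (fun t => √(x^2+t^2))) / fun t => √(x^2+t^2)) :=
    funext first
  rw [e] at d1
  have := d1.unique d2
  simp only [id, zero_mul, add_zero, one_mul, Pi.div_apply, Function.comp, hs0] at this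
  rw [← this]
  simp [mom]
  rfl

lemma sL_good (hN : 2 ≤ N)
    (hμinv : ∀ e : EuclideanSpace ℝ (Fin N) ≃ₗᵢ[ℝ] EuclideanSpace ℝ (Fin N),
      Measure.map (sphereMap e) μ = μ) (i0 : Fin N) :
    GoodL N (sL μ (EuclideanSpace.single i0 1)) := by
  set u : EuclideanSpace ℝ (Fin N) := EuclideanSpace.single i0 1 with hu
  have hu1 : ‖u‖ = 1 := by simp [hu]
  have hub : ∀ a : UnitSphere N, |⟪(a : EuclideanSpace ℝ (Fin N)), u⟫| ≤ 1 :=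
    fun a => (sphere_inner_le u a).trans hu1.le
  have I : ∀ k x, Integrable (fun τ : UnitSphere N =>
      1 * ⟪(τ : EuclideanSpace ℝ (Fin N)), u⟫^k * exp (x * ⟪(τ : EuclideanSpace ℝ (Fin N)), u⟫)) μ :=
    fun k x => mom_integrable (inner_meas u) measurable_const hub (K := 1) (w := fun _ => 1)
      (by simp) k x
  refine ⟨fun x => ?_, fun k y => mom_hasDerivAt (inner_meas u) measurable_const hub (K := 1)
    (by simp) k y, fun k x => ?_, fun x hx => ?_⟩
  · have := I 0 x
    simp only [pow_zero, one_mul] at this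
    simp only [sL, mom, pow_zero, one_mul]
    exact integral_exp_pos this
  · refine (abs_integral_le_integral_abs).trans ?_
    apply integral_mono (I k x).abs (I 0 x)
    intro τ
    simp only [abs_mul, abs_pow, abs_exp, pow_zero, abs_one, one_mul]
    exact mul_le_of_le_one_left (exp_nonneg _) (pow_le_one₀ (abs_nonneg _) (hub τ))
  · rcases hx.eq_or_lt with rfl | hx
    · have := inv_integral hμinv (u := u) (v := -u) (by simp) continuous_id
      simp only [id, inner_neg_right, integral_neg] at this
      simp [sL, mom]
      right
      linarith
    · have key : ∀ j ∈ Finset.univ.erase i0,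
          ∫ τ, exp (x * ⟪(τ : EuclideanSpace ℝ (Fin N)), u⟫) *
            ⟪(τ : EuclideanSpace ℝ (Fin N)), EuclideanSpace.single j 1⟫^2 ∂μ = sL μ u 1 x / x := by
        intro j hj
        refine mixed_moment hμinv hu1 (by simp) ?_ hx
        have : j ≠ i0 := Finset.ne_of_mem_erase hj
        simp [hu, EuclideanSpace.inner_single_right, this]
      have s := Finset.sum_congr rfl key
      rw [← integral_finsetSum] at s
      · rw [Finset.sum_const, Finset.card_erase_of_mem (Finset.mem_univ _), Finset.card_univ,
          Fintype.card_fin, nsmul_eq_mul, Nat.cast_sub (by omega)] at s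
        have : sL μ u 0 x - sL μ u 2 x = ((N:ℝ) - (1:ℕ)) * (sL μ u 1 x / x) := by
          rw [← s]
          simp only [sL, mom]
          rw [← integral_sub (I 0 x) (I 2 x)]
          congr 1; ext τ
          rw [← Finset.mul_sum]
          have n1 : ‖(τ : EuclideanSpace ℝ (Fin N))‖^2 = 1 := by
            rw [mem_sphere_zero_iff_norm.1 τ.2]; simp
          rw [EuclideanSpace.norm_sq_eq] at n1
          rw [← Finset.add_sum_erase _ _ (Finset.mem_univ i0)] at n1
          simp only [hu, EuclideanSpace.inner_single_right, Real.norm_eq_abs, sq_abs, one_mul,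
            conj_trivial, pow_zero] at n1 ⊢
          linear_combination (-exp (x * (τ : EuclideanSpace ℝ (Fin N)) i0)) * n1
        rw [this]
        push_cast
        field_simp
      · intro j hj
        have := mom_integrable (ρ := μ) (c := fun τ => ⟪(τ : EuclideanSpace ℝ (Fin N)), u⟫)
          (w := fun τ => ⟪(τ : EuclideanSpace ℝ (Fin N)), EuclideanSpace.single j 1⟫^2)
          (inner_meas u) ((inner_meas _).pow_const 2) (K := 1) hub (fun a => by
            rw [abs_pow]
            exact pow_le_one₀ (abs_nonneg _) ((sphere_inner_le _ a).trans (by simp))) 0 x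
        simpa [mul_comm] using this

end sphere

/-- The Laplace functions of the density `sin^M` in the variable `cos`. -/
def bJ (M : ℕ) (k : ℕ) (x : ℝ) : ℝ :=
  mom (volume.restrict (Set.Ioc 0 π)) cos (fun θ => sin θ ^ M) k x

lemma bJ_d (M k : ℕ) (x : ℝ) : HasDerivAt (bJ M k) (bJ M (k+1) x) x :=
  mom_hasDerivAt measurable_cos (measurable_sin.pow_const M) abs_cos_le_one (K := 1)
    (fun θ => by rw [abs_pow]; exact pow_le_one₀ (abs_nonneg _) (abs_sin_le_one θ)) k x

lemma bJ_eq (M k : ℕ) (x : ℝ) :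
    bJ M k x = ∫ θ in (0:ℝ)..π, sin θ ^ M * cos θ ^ k * exp (x * cos θ) := by
  rw [intervalIntegral.integral_of_le pi_pos.le]; rfl

lemma bJ_pos (M : ℕ) (x : ℝ) : 0 < bJ M 0 x := by
  rw [bJ_eq]
  apply intervalIntegral.intervalIntegral_pos_of_pos_on
  · apply Continuous.intervalIntegrable; fun_prop
  · intro θ hθ
    have := sin_pos_of_mem_Ioo hθ
    positivity
  · exact pi_pos

lemma bJ_ibp (M : ℕ) (x : ℝ) : ((M:ℝ) + 1) * bJ M 1 x =
    x * ∫ θ in (0:ℝ)..π, exp (x * cos θ) * sin θ ^ (M+2) := by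
  have h := intervalIntegral.integral_mul_deriv_eq_deriv_mul (a := 0) (b := π)
    (u := fun θ => exp (x * cos θ)) (v := fun θ => sin θ ^ (M+1))
    (u' := fun θ => exp (x * cos θ) * (x * (-sin θ)))
    (v' := fun θ => ((M:ℝ)+1) * sin θ ^ M * cos θ)
    (fun θ _ => ((hasDerivAt_cos θ).const_mul x).exp)
    (fun θ _ => ((hasDerivAt_sin θ).pow (M+1)).congr_deriv (by simp))
    (by apply Continuous.intervalIntegrable; fun_prop)
    (by apply Continuous.intervalIntegrable; fun_prop)
  simp only [sin_pi, sin_zero, ne_eq, Nat.succ_ne_zero, not_false_eq_true, zero_pow, mul_zero,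
    sub_zero, zero_sub] at h
  rw [bJ_eq, ← intervalIntegral.integral_const_mul, ← intervalIntegral.integral_const_mul]
  rw [← intervalIntegral.integral_neg] at h
  calc _ = _ := by
        congr 1; ext θ
        change _ = exp (x * cos θ) * (((M:ℝ)+1) * sin θ ^ M * cos θ)
        ring
    _ = _ := h
    _ = _ := by congr 1; ext θ; ring

lemma bJ_two (M : ℕ) (x : ℝ) : bJ M 0 x - bJ M 2 x =
    ∫ θ in (0:ℝ)..π, exp (x * cos θ) * sin θ ^ (M+2) := by
  rw [bJ_eq, bJ_eq, ← intervalIntegral.integral_sub]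
  · congr 1; ext θ
    have := sin_sq_add_cos_sq θ
    rw [pow_add]
    linear_combination (-exp (x * cos θ) * sin θ ^ M) * this
  · apply Continuous.intervalIntegrable; fun_prop
  · apply Continuous.intervalIntegrable; fun_prop

lemma bessel_eq_bJ (M : ℕ) (x : ℝ) : besselRatio (M+2) x = bJ M 1 x / bJ M 0 x := by
  unfold besselRatio
  have h := bJ_ibp M x
  have h0 : bJ M 0 x = ∫ θ in (0:ℝ)..π, exp (x * cos θ) * sin θ ^ (M+2-2) := by
    rw [bJ_eq]; congr 1; ext θ; simp; ring
  rw [← h0]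
  congr 1
  have : (M:ℝ) + 1 ≠ 0 := by positivity
  push_cast
  rw [show (M:ℝ) + 2 - 1 = M + 1 by ring]
  field_simp
  linarith

lemma bessel_eq_rat {N : ℕ} {L : ℕ → ℝ → ℝ} (h : GoodL N L) (hN : 2 ≤ N) {x : ℝ} (hx : 0 < x) :
    besselRatio N x = rat L x := by
  obtain ⟨M, rfl⟩ : ∃ M, N = M + 2 := ⟨N - 2, by omega⟩
  rw [bessel_eq_bJ, rat, div_eq_div_iff (bJ_pos M x).ne' (h.pos x).ne']
  have cJ : ∀ k, Continuous (bJ M k) := fun k =>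
    continuous_iff_continuousAt.2 fun x => (bJ_d M k x).continuousAt
  have ode : ∀ y, ((M:ℝ) + 1) * bJ M 1 y = y * (bJ M 0 y - bJ M 2 y) := fun y => by
    rw [bJ_two, bJ_ibp]
  have dd : ∀ y, 0 ≤ y → HasDerivAt
      (fun y => y^(M+1) * (bJ M 1 y * L 0 y - L 1 y * bJ M 0 y)) 0 y := by
    intro y hy
    refine ((hasDerivAt_pow (M+1) y).mul (((bJ_d M 1 y).mul (h.d 0 y)).sub
      ((h.d 1 y).mul (bJ_d M 0 y)))).congr_deriv ?_
    have o1 := ode y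
    have o2 := h.ode y hy
    push_cast at o2
    simp
    rw [pow_succ]
    linear_combination y^M * L 0 y * o1 - y^M * bJ M 0 y * o2
  have := constant_of_has_deriv_right_zero (a := 0) (b := x)
    (fun y hy => (dd y hy.1).continuousAt.continuousWithinAt)
    (fun y hy => (dd y hy.1).hasDerivWithinAt) x ⟨hx.le, le_rfl⟩
  simp at this
  rcases this with h | h
  · exact absurd h hx.ne'
  · linarith


section gibbs
variable {N : ℕ}

/-- spin sum without the `i`-th spin -/
def Sm {n : ℕ} (σ : Fin n → UnitSphere N) (i : Fin n) : EuclideanSpace ℝ (Fin N) :=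
  totalSpin σ - (σ i : EuclideanSpace ℝ (Fin N))

/-- `A_i - B_i` -/
def Tm {n : ℕ} (f : ℝ → ℝ) (β : ℝ) (σ : Fin n → UnitSphere N) (i : Fin n) : ℝ :=
  ⟪(σ i : EuclideanSpace ℝ (Fin N)), Sm σ i⟫ - ‖Sm σ i‖ * f (β / n * ‖Sm σ i‖)

lemma spin_norm (τ : UnitSphere N) : ‖(τ : EuclideanSpace ℝ (Fin N))‖ = 1 :=
  mem_sphere_zero_iff_norm.1 τ.2

lemma totalSpin_le {n : ℕ} (σ : Fin n → UnitSphere N) : ‖totalSpin σ‖ ≤ n := by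
  refine (norm_sum_le _ _).trans ?_
  simp [spin_norm]

lemma Sm_eq {n : ℕ} (σ : Fin n → UnitSphere N) (i : Fin n) :
    Sm σ i = ∑ j ∈ Finset.univ.erase i, (σ j : EuclideanSpace ℝ (Fin N)) := by
  rw [Sm, totalSpin, ← Finset.add_sum_erase _ _ (Finset.mem_univ i)]; simp

lemma Sm_le {n : ℕ} (σ : Fin n → UnitSphere N) (i : Fin n) : ‖Sm σ i‖ ≤ n - 1 := by
  rw [Sm_eq]
  refine (norm_sum_le _ _).trans ?_
  simp [spin_norm]
  have := i.pos
  rw [Nat.cast_sub (by omega)]; simp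

lemma totalSpin_update {n : ℕ} (σ : Fin n → UnitSphere N) (i : Fin n) (τ : UnitSphere N) :
    totalSpin (Function.update σ i τ) = Sm σ i + τ := by
  rw [Sm_eq, totalSpin, ← Finset.add_sum_erase _ _ (Finset.mem_univ i), add_comm]
  congr 1
  · apply Finset.sum_congr rfl
    intro j hj
    rw [Function.update_of_ne (Finset.ne_of_mem_erase hj)]
  · simp

lemma weight_eq {n : ℕ} (β : ℝ) (σ : Fin n → UnitSphere N) :
    gibbsWeight N n β σ = exp (β / (2 * n) * ‖totalSpin σ‖^2) := by
  unfold gibbsWeight totalSpin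
  rw [← real_inner_self_eq_norm_sq, sum_inner]
  simp_rw [inner_sum]

lemma normsq_split {n : ℕ} (σ : Fin n → UnitSphere N) (i : Fin n) :
    ‖totalSpin σ‖^2 = ‖Sm σ i‖^2 + 2 * ⟪(σ i : EuclideanSpace ℝ (Fin N)), Sm σ i⟫ + 1 := by
  have : totalSpin σ = Sm σ i + σ i := by simp [Sm]
  rw [this, norm_add_sq_real, spin_norm, real_inner_comm]; ring

lemma sum_inner_Sm {n : ℕ} (σ : Fin n → UnitSphere N) :
    ∑ i, ⟪(σ i : EuclideanSpace ℝ (Fin N)), Sm σ i⟫ = ‖totalSpin σ‖^2 - n := by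
  simp only [Sm, inner_sub_right, Finset.sum_sub_distrib, ← sum_inner]
  change ⟪totalSpin σ, totalSpin σ⟫ - _ = _
  rw [real_inner_self_eq_norm_sq]
  simp [spin_norm]

variable {μ : Measure (UnitSphere N)} [IsProbabilityMeasure μ]

lemma cond_mean
    (hμinv : ∀ e : EuclideanSpace ℝ (Fin N) ≃ₗᵢ[ℝ] EuclideanSpace ℝ (Fin N),
      Measure.map (sphereMap e) μ = μ) {u : EuclideanSpace ℝ (Fin N)} (hu : ‖u‖ = 1)
    (hG : GoodL N (sL μ u)) (v : EuclideanSpace ℝ (Fin N)) (κ : ℝ) :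
    ∫ τ, (⟪(τ : EuclideanSpace ℝ (Fin N)), v⟫ - ‖v‖ * rat (sL μ u) (κ * ‖v‖)) *
      exp (κ * ⟪(τ : EuclideanSpace ℝ (Fin N)), v⟫) ∂μ = 0 := by
  have hub : ∀ a : UnitSphere N, |⟪(a : EuclideanSpace ℝ (Fin N)), u⟫| ≤ 1 :=
    fun a => (sphere_inner_le u a).trans hu.le
  have I : ∀ k x, Integrable (fun τ : UnitSphere N =>
      1 * ⟪(τ : EuclideanSpace ℝ (Fin N)), u⟫^k * exp (x * ⟪(τ : EuclideanSpace ℝ (Fin N)), u⟫)) μ :=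
    fun k x => mom_integrable (inner_meas u) measurable_const hub (K := 1) (w := fun _ => 1)
      (by simp) k x
  have := inv_integral hμinv (u := v) (v := ‖v‖ • u) (by simp [norm_smul, hu])
    (G := fun s => (s - ‖v‖ * rat (sL μ u) (κ * ‖v‖)) * exp (κ * s)) (by fun_prop)
  rw [this]
  have e : ∀ τ : UnitSphere N, (⟪(τ : EuclideanSpace ℝ (Fin N)), ‖v‖ • u⟫
      - ‖v‖ * rat (sL μ u) (κ * ‖v‖)) * exp (κ * ⟪(τ : EuclideanSpace ℝ (Fin N)), ‖v‖ • u⟫)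
      = ‖v‖ * (1 * ⟪(τ : EuclideanSpace ℝ (Fin N)), u⟫^1 *
          exp ((κ * ‖v‖) * ⟪(τ : EuclideanSpace ℝ (Fin N)), u⟫))
        - ‖v‖ * rat (sL μ u) (κ * ‖v‖) * (1 * ⟪(τ : EuclideanSpace ℝ (Fin N)), u⟫^0 *
          exp ((κ * ‖v‖) * ⟪(τ : EuclideanSpace ℝ (Fin N)), u⟫)) := by
    intro τ
    rw [inner_smul_right, ← mul_assoc]; ring
  simp_rw [e]
  rw [integral_sub ((I 1 _).const_mul _) ((I 0 _).const_mul _), integral_const_mul,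
    integral_const_mul]
  change ‖v‖ * sL μ u 1 (κ * ‖v‖) - ‖v‖ * rat (sL μ u) (κ * ‖v‖) * sL μ u 0 (κ * ‖v‖) = 0
  have h0 := (hG.pos (κ * ‖v‖)).ne'
  rw [mul_assoc, rat, div_mul_cancel₀ _ h0, sub_self]

lemma exp_int (v : EuclideanSpace ℝ (Fin N)) (κ : ℝ) :
    Integrable (fun τ : UnitSphere N => exp (κ * ⟪(τ : EuclideanSpace ℝ (Fin N)), v⟫)) μ := by
  have hc : Continuous (fun τ : UnitSphere N => exp (κ * ⟪(τ : EuclideanSpace ℝ (Fin N)), v⟫)) := by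
    have := (continuous_subtype_val (p := fun x => x ∈ UnitSphere N)).inner
      (continuous_const (y := v)) (𝕜 := ℝ)
    fun_prop
  exact hc.integrable_of_hasCompactSupport (HasCompactSupport.of_compactSpace _)

lemma cont_int {X : Type*} [TopologicalSpace X] [CompactSpace X] [MeasurableSpace X]
    [OpensMeasurableSpace X] {ν : Measure X} [IsFiniteMeasure ν] {g : X → ℝ} (hg : Continuous g) :
    Integrable g ν := hg.integrable_of_hasCompactSupport (HasCompactSupport.of_compactSpace _)

lemma inner_cont (v : EuclideanSpace ℝ (Fin N)) :
    Continuous (fun τ : UnitSphere N => ⟪(τ : EuclideanSpace ℝ (Fin N)), v⟫) :=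
  continuous_subtype_val.inner continuous_const

lemma D1_eq
    (hμinv : ∀ e : EuclideanSpace ℝ (Fin N) ≃ₗᵢ[ℝ] EuclideanSpace ℝ (Fin N),
      Measure.map (sphereMap e) μ = μ) {u : EuclideanSpace ℝ (Fin N)} (hu : ‖u‖ = 1)
    (hG : GoodL N (sL μ u)) {n : ℕ} (β b : ℝ) (σ : Fin n → UnitSphere N) :
    D1 N n β b μ σ = (1 / (n:ℝ)) * (√n * (β^2 / ((n:ℝ)^2 * b^2)) * 2 *
      ∑ i, Tm (rat (sL μ u)) β σ i) := by
  unfold D1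
  congr 1
  rw [Finset.mul_sum]
  apply Finset.sum_congr rfl
  intro i _
  set v := Sm σ i with hv
  set Z := ∫ τ', exp (β / n * ⟪(τ' : EuclideanSpace ℝ (Fin N)), v⟫) ∂μ with hZ
  have hZp : 0 < Z := integral_exp_pos (exp_int v _)
  set K := √n * (β^2 / ((n:ℝ)^2 * b^2)) * 2 with hK
  have e : ∀ τ : UnitSphere N, (Wspin N n β b σ - Wspin N n β b (Function.update σ i τ)) *
      condDens N n β μ σ i τ = (K * Tm (rat (sL μ u)) β σ i / Z) *
        exp (β / n * ⟪(τ : EuclideanSpace ℝ (Fin N)), v⟫) - (K / Z) *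
        ((⟪(τ : EuclideanSpace ℝ (Fin N)), v⟫ - ‖v‖ * rat (sL μ u) (β / n * ‖v‖)) *
          exp (β / n * ⟪(τ : EuclideanSpace ℝ (Fin N)), v⟫)) := by
    intro τ
    unfold Wspin
    rw [totalSpin_update, normsq_split σ i, norm_add_sq_real, spin_norm,
      real_inner_comm (τ : EuclideanSpace ℝ (Fin N)) (Sm σ i)]
    change _ * (exp (β / n * ⟪(τ : EuclideanSpace ℝ (Fin N)), v⟫) / Z) = _
    simp only [Tm, ← hv, hK]
    ring
  simp_rw [e]
  rw [integral_sub ((exp_int v _).const_mul _)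
    (Integrable.const_mul (cont_int (by have := inner_cont v; fun_prop)) _), integral_const_mul,
    integral_const_mul, cond_mean hμinv hu hG, ← hZ]
  rw [mul_zero, sub_zero, div_mul_cancel₀ _ hZp.ne']

lemma totalSpin_cont {n : ℕ} : Continuous (totalSpin : (Fin n → UnitSphere N) → _) := by
  unfold totalSpin
  exact continuous_finsetSum _ fun i _ => continuous_subtype_val.comp (continuous_apply i)

lemma Sm_cont {n : ℕ} (i : Fin n) : Continuous (fun σ : Fin n → UnitSphere N => Sm σ i) :=
  totalSpin_cont.sub (continuous_subtype_val.comp (continuous_apply i))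

lemma GoodL.rat_cont {L} (h : GoodL N L) : Continuous (rat L) :=
  continuous_iff_continuousAt.2 fun x => (h.rat_d x).continuousAt

lemma Tm_cont {n : ℕ} {f : ℝ → ℝ} (hf : Continuous f) (β : ℝ) (i : Fin n) :
    Continuous (fun σ : Fin n → UnitSphere N => Tm f β σ i) := by
  have h1 := Sm_cont (N := N) i
  have h2 : Continuous (fun σ : Fin n → UnitSphere N => (σ i : EuclideanSpace ℝ (Fin N))) :=
    continuous_subtype_val.comp (continuous_apply i)
  have h3 := h2.inner h1 (𝕜 := ℝ)
  unfold Tm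
  fun_prop

lemma weight_cont {n : ℕ} (β : ℝ) : Continuous (gibbsWeight N n β) := by
  have h1 := totalSpin_cont (N := N) (n := n)
  have : gibbsWeight N n β = fun σ => exp (β / (2 * n) * ‖totalSpin σ‖^2) := funext (weight_eq β)
  rw [this]
  fun_prop

lemma orth
    (hμinv : ∀ e : EuclideanSpace ℝ (Fin N) ≃ₗᵢ[ℝ] EuclideanSpace ℝ (Fin N),
      Measure.map (sphereMap e) μ = μ) {u : EuclideanSpace ℝ (Fin N)} (hu : ‖u‖ = 1)
    (hG : GoodL N (sL μ u)) {n : ℕ} (β : ℝ) (i : Fin n) {φ : EuclideanSpace ℝ (Fin N) → ℝ}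
    (hφ : Continuous φ) :
    ∫ σ, Tm (rat (sL μ u)) β σ i * φ (Sm σ i) * gibbsWeight N n β σ
      ∂(Measure.pi fun _ : Fin n => μ) = 0 := by
  obtain ⟨m, rfl⟩ : ∃ m, n = m + 1 := ⟨n - 1, by have := i.pos; omega⟩
  have mp := (measurePreserving_piFinSuccAbove (fun _ : Fin (m+1) => μ) i).symm
  have hcont : Continuous (fun σ : Fin (m+1) → UnitSphere N =>
      Tm (rat (sL μ u)) β σ i * φ (Sm σ i) * gibbsWeight N (m+1) β σ) := by
    have h1 := Tm_cont (N := N) hG.rat_cont β i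
    have h2 := weight_cont (N := N) (n := m+1) β
    have h3 := Sm_cont (N := N) i
    fun_prop
  rw [← mp.integral_comp', integral_prod_symm]
  · have inner0 : ∀ σ' : Fin m → UnitSphere N, ∫ τ : UnitSphere N,
        (fun σ : Fin (m+1) → UnitSphere N =>
          Tm (rat (sL μ u)) β σ i * φ (Sm σ i) * gibbsWeight N (m+1) β σ)
          ((MeasurableEquiv.piFinSuccAbove (fun _ => UnitSphere N) i).symm (τ, σ')) ∂μ = 0 := by
      intro σ'
      have hsm : ∀ τ : UnitSphere N,
          Sm ((MeasurableEquiv.piFinSuccAbove (fun _ => UnitSphere N) i).symm (τ, σ')) i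
          = totalSpin σ' := by
        intro τ
        change Sm (i.insertNth τ σ') i = totalSpin σ'
        simp [Sm, totalSpin, Fin.sum_univ_succAbove _ i]
      have hi : ∀ τ : UnitSphere N,
          ((MeasurableEquiv.piFinSuccAbove (fun _ => UnitSphere N) i).symm (τ, σ')) i = τ := by
        intro τ
        change (i.insertNth τ σ' : Fin (m+1) → UnitSphere N) i = τ
        simp
      set v := totalSpin σ'
      have e : ∀ τ : UnitSphere N, (fun σ : Fin (m+1) → UnitSphere N =>
          Tm (rat (sL μ u)) β σ i * φ (Sm σ i) * gibbsWeight N (m+1) β σ)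
          ((MeasurableEquiv.piFinSuccAbove (fun _ => UnitSphere N) i).symm (τ, σ'))
          = (φ v * exp (β / (2 * (m+1:ℕ)) * (‖v‖^2+1))) *
          ((⟪(τ : EuclideanSpace ℝ (Fin N)), v⟫ - ‖v‖ * rat (sL μ u) (β / (m+1:ℕ) * ‖v‖)) *
          exp (β / (m+1:ℕ) * ⟪(τ : EuclideanSpace ℝ (Fin N)), v⟫)) := by
        intro τ
        simp only [weight_eq, normsq_split _ i, Tm, hsm, hi]
        rw [show β / (2 * (m+1:ℕ)) * (‖v‖^2 + 2 * ⟪(τ : EuclideanSpace ℝ (Fin N)), v⟫ + 1)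
          = β / (2 * (m+1:ℕ)) * (‖v‖^2+1) + β / (m+1:ℕ) * ⟪(τ : EuclideanSpace ℝ (Fin N)), v⟫ by
            field_simp; ring, exp_add]
        ring
      simp_rw [e]
      rw [integral_const_mul, cond_mean hμinv hu hG, mul_zero]
    simp_rw [inner0]
    simp
  · exact mp.integrable_comp_of_integrable (cont_int hcont)

lemma Z_lower {u : EuclideanSpace ℝ (Fin N)} (hu : ‖u‖ = 1)
    {n : ℕ} (hn : 1 ≤ n) {β : ℝ} (hβ : 0 < β) (b : ℝ) :
    (sL μ u 0 b * exp (-(b^2/(2*β))))^n ≤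
      ∫ σ, gibbsWeight N n β σ ∂(Measure.pi fun _ : Fin n => μ) := by
  have hn' : (0:ℝ) < n := by exact_mod_cast hn
  have e1 := integral_fintype_prod_eq_pow (ι := Fin n) (μ := μ) (𝕜 := ℝ)
    (fun τ : UnitSphere N => exp (b * ⟪(τ : EuclideanSpace ℝ (Fin N)), u⟫) * exp (-(b^2/(2*β))))
  have e2 : ∫ τ : UnitSphere N,
      exp (b * ⟪(τ : EuclideanSpace ℝ (Fin N)), u⟫) * exp (-(b^2/(2*β))) ∂μ
      = sL μ u 0 b * exp (-(b^2/(2*β))) := by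
    rw [integral_mul_const]; simp [sL, mom]
  rw [e2, Fintype.card_fin] at e1
  rw [← e1]
  have hc : Continuous fun σ : Fin n → UnitSphere N =>
      ∏ i, (exp (b * ⟪(σ i : EuclideanSpace ℝ (Fin N)), u⟫) * exp (-(b^2/(2*β)))) := by
    apply continuous_finsetProd
    intro i _
    have := (inner_cont u).comp (continuous_apply (A := fun _ : Fin n => UnitSphere N) i)
    simp only [Function.comp_def] at this
    fun_prop
  refine integral_mono (cont_int hc) (cont_int (weight_cont β)) fun σ => ?_
  simp only [weight_eq, ← exp_add, ← exp_sum]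
  apply exp_le_exp.2
  rw [Finset.sum_add_distrib, ← Finset.mul_sum, ← sum_inner]
  change b * ⟪totalSpin σ, u⟫ + _ ≤ _
  simp only [Finset.sum_const, Finset.card_univ, Fintype.card_fin, nsmul_eq_mul]
  have h1 : b * ⟪totalSpin σ, u⟫ ≤ |b| * ‖totalSpin σ‖ := by
    refine (le_abs_self _).trans ?_
    rw [abs_mul]
    have := abs_real_inner_le_norm (totalSpin σ) u
    rw [hu, mul_one] at this
    gcongr
  have h2 : β / (2*n) * ‖totalSpin σ‖^2 - (|b| * ‖totalSpin σ‖ + n * (-(b^2/(2*β))))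
      = (β * ‖totalSpin σ‖ - n * |b|)^2 / (2 * n * β) := by
    rw [← sq_abs b]; field_simp; ring
  have h3 : 0 ≤ (β * ‖totalSpin σ‖ - n * |b|)^2 / (2 * n * β) := by positivity
  linarith

end gibbs

section final
variable {N : ℕ}

/-- normalized magnetization `x = β|S|/n` -/
def Xm {n : ℕ} (β : ℝ) (σ : Fin n → UnitSphere N) : ℝ := β / n * ‖totalSpin σ‖

lemma Xm_nonneg {n : ℕ} {β : ℝ} (hβ : 0 < β) (σ : Fin n → UnitSphere N) : 0 ≤ Xm β σ := by
  unfold Xm; positivity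

lemma Xm_le {n : ℕ} (hn : 1 ≤ n) {β : ℝ} (hβ : 0 < β) (σ : Fin n → UnitSphere N) :
    Xm β σ ≤ β := by
  have hn' : (0:ℝ) < n := by exact_mod_cast hn
  have := totalSpin_le σ
  calc β / n * ‖totalSpin σ‖ ≤ β / n * n := by gcongr
    _ = β := by field_simp

lemma Xm_cont {n : ℕ} (β : ℝ) : Continuous (Xm β : (Fin n → UnitSphere N) → ℝ) := by
  have := totalSpin_cont (N := N) (n := n)
  unfold Xm
  fun_prop

lemma T_approx {L : ℕ → ℝ → ℝ} (h : GoodL N L) {n : ℕ} (hn : 1 ≤ n) {β : ℝ} (hβ : 0 < β)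
    (σ : Fin n → UnitSphere N) :
    |∑ i, Tm (rat L) β σ i - n^2 / β^2 * (Xm β σ * (Xm β σ - β * rat L (Xm β σ)))|
      ≤ n * (2 + 2 * β) := by
  have hn' : (0:ℝ) < n := by exact_mod_cast hn
  set s := ‖totalSpin σ‖ with hs
  have hsn : s ≤ n := totalSpin_le σ
  have hs0 : 0 ≤ s := norm_nonneg _
  have e1 : (n:ℝ)^2 / β^2 * (Xm β σ * (Xm β σ - β * rat L (Xm β σ))) =
      s^2 - n * (s * rat L (β / n * s)) := by
    unfold Xm; rw [← hs]; field_simp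
  have each : ∀ i, |s * rat L (β / n * s) - ‖Sm σ i‖ * rat L (β / n * ‖Sm σ i‖)| ≤ 1 + 2 * β := by
    intro i
    set r := ‖Sm σ i‖
    have hr : |s - r| ≤ 1 := by
      have := abs_norm_sub_norm_le (totalSpin σ) (Sm σ i)
      refine this.trans ?_
      simp [Sm]
    have h1 : |rat L (β / n * s) - rat L (β / n * r)| ≤ 2 * (β / n) := by
      refine (h.rat_lip _ _).trans ?_
      rw [← mul_sub, abs_mul, abs_of_pos (by positivity : 0 < β / n)]
      have : β / n * |s - r| ≤ β / n * 1 := by gcongr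
      linarith
    calc |s * rat L (β / n * s) - r * rat L (β / n * r)|
        = |s * (rat L (β / n * s) - rat L (β / n * r)) + (s - r) * rat L (β / n * r)| := by
          congr 1; ring
      _ ≤ s * |rat L (β / n * s) - rat L (β / n * r)| + |s - r| * |rat L (β / n * r)| := by
          refine (abs_add_le _ _).trans ?_
          rw [abs_mul, abs_mul, abs_of_nonneg hs0]
      _ ≤ n * (2 * (β / n)) + 1 * 1 := by
          have := h.rat_bd (β / n * r)
          gcongr
      _ = 1 + 2 * β := by field_simp; ring
  have e2 : ∑ i, Tm (rat L) β σ i - (s^2 - n * (s * rat L (β / n * s))) =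
      ∑ i, (s * rat L (β / n * s) - ‖Sm σ i‖ * rat L (β / n * ‖Sm σ i‖)) - n := by
    simp only [Tm, Finset.sum_sub_distrib, sum_inner_Sm, Finset.sum_const, Finset.card_univ,
      Fintype.card_fin, nsmul_eq_mul]
    ring
  rw [e1, e2]
  have e3 : |∑ i, (s * rat L (β / n * s) - ‖Sm σ i‖ * rat L (β / n * ‖Sm σ i‖))|
      ≤ n * (1 + 2 * β) := by
    refine (Finset.abs_sum_le_sum_abs _ _).trans ?_
    refine (Finset.sum_le_sum fun i _ => each i).trans ?_
    simp
    linarith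
  refine (abs_sub _ _).trans ?_
  rw [abs_of_pos hn']
  linarith

lemma Tm_bd {L : ℕ → ℝ → ℝ} (h : GoodL N L) {n : ℕ} {β : ℝ}
    (σ : Fin n → UnitSphere N) (i : Fin n) : |Tm (rat L) β σ i| ≤ 2 * n := by
  have h1 := sphere_inner_le (Sm σ i) (σ i)
  have h2 := Sm_le σ i
  have h3 : |‖Sm σ i‖ * rat L (β / n * ‖Sm σ i‖)| ≤ ‖Sm σ i‖ := by
    rw [abs_mul, abs_norm]
    exact mul_le_of_le_one_right (norm_nonneg _) (h.rat_bd _)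
  unfold Tm
  refine (abs_sub _ _).trans ?_
  linarith

/-- pointwise upper bound for the drift times the deviation -/
lemma drift_le {L : ℕ → ℝ → ℝ} (h : GoodL N L) {n : ℕ} (hn : 1 ≤ n) {β b : ℝ} (hβ : 0 < β)
    (hb : 0 < b) (hbβ : b ≤ β) (σ : Fin n → UnitSphere N) :
    Xm β σ * (Xm β σ - β * rat L (Xm β σ)) * (Xm β σ ^ 2 - b^2) ≤
      β^2 / n^2 * ∑ i, Tm (rat L) β σ i * ((β / n * ‖Sm σ i‖)^2 - b^2)
        + β^4 * (6 + 2 * β) / n := by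
  have hn' : (0:ℝ) < n := by exact_mod_cast hn
  set X := Xm β σ with hX
  have X0 : 0 ≤ X := Xm_nonneg hβ σ
  have X1 : X ≤ β := Xm_le hn hβ σ
  set φ := X^2 - b^2 with hφ
  have hφb : |φ| ≤ β^2 := by
    have : X^2 ≤ β^2 := by gcongr
    have : b^2 ≤ β^2 := by gcongr
    rw [abs_le]
    constructor <;> nlinarith [sq_nonneg X, sq_nonneg b]
  have hT := T_approx h hn hβ σ
  rw [← hX] at hT
  set T := ∑ i, Tm (rat L) β σ i with hTdef
  set H := X * (X - β * rat L X) with hH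
  -- step 1
  have s1 : H * φ ≤ β^2 / n^2 * (T * φ) + β^2 / n^2 * (n * (2 + 2 * β) * β^2) := by
    have : |(T - n^2 / β^2 * H) * φ| ≤ n * (2 + 2 * β) * β^2 := by
      rw [abs_mul]; gcongr
    have h2 := neg_le_of_abs_le this
    have h3 : β^2 / n^2 * (-(n * (2 + 2 * β) * β^2)) ≤ β^2 / n^2 * ((T - n^2 / β^2 * H) * φ) := by
      gcongr
    have h4 : β^2 / n^2 * ((T - n^2 / β^2 * H) * φ) = β^2 / n^2 * (T * φ) - H * φ := by
      field_simp
    linarith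
  have s2 : T * φ ≤ ∑ i, Tm (rat L) β σ i * ((β / n * ‖Sm σ i‖)^2 - b^2) + 4 * β^2 * n := by
    have each : ∀ i ∈ Finset.univ, Tm (rat L) β σ i * φ ≤
        Tm (rat L) β σ i * ((β / n * ‖Sm σ i‖)^2 - b^2) + 4 * β^2 := by
      intro i _
      have d : φ - ((β / n * ‖Sm σ i‖)^2 - b^2) =
          β^2 / n^2 * (2 * ⟪(σ i : EuclideanSpace ℝ (Fin N)), Sm σ i⟫ + 1) := by
        rw [hφ, hX, Xm, mul_pow, normsq_split σ i]; field_simp; ring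
      have h1 := sphere_inner_le (Sm σ i) (σ i)
      have h2 := Sm_le σ i
      have d2 : |φ - ((β / n * ‖Sm σ i‖)^2 - b^2)| ≤ β^2 / n^2 * (2 * n) := by
        rw [d, abs_mul, abs_of_pos (by positivity : 0 < β^2 / (n:ℝ)^2)]
        gcongr
        rw [abs_le] at h1 ⊢
        constructor <;> linarith
      have d3 : |Tm (rat L) β σ i * (φ - ((β / n * ‖Sm σ i‖)^2 - b^2))|
          ≤ 2 * n * (β^2 / n^2 * (2 * n)) := by
        rw [abs_mul]
        have := Tm_bd h σ i (β := β)
        gcongr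
      have d4 : 2 * n * (β^2 / n^2 * (2 * n)) = 4 * β^2 := by field_simp; ring
      rw [d4] at d3
      have := le_of_abs_le d3
      linarith
    rw [hTdef, Finset.sum_mul]
    refine (Finset.sum_le_sum each).trans ?_
    rw [Finset.sum_add_distrib]
    simp
    linarith
  have s3 := mul_le_mul_of_nonneg_left s2 (by positivity : 0 ≤ β^2 / (n:ℝ)^2)
  refine s1.trans ?_
  have : β^2 / (n:ℝ)^2 * (n * (2 + 2 * β) * β^2) + β^2 / n^2 * (4 * β^2 * n)
    = β^4 * (6 + 2 * β) / n := by field_simp; ring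
  rw [mul_add] at s3
  linarith

variable {μ : Measure (UnitSphere N)} [IsProbabilityMeasure μ]

/-- The concentration estimate, unnormalized. -/
lemma conc (hN : 2 ≤ N)
    (hμinv : ∀ e : EuclideanSpace ℝ (Fin N) ≃ₗᵢ[ℝ] EuclideanSpace ℝ (Fin N),
      Measure.map (sphereMap e) μ = μ) {u : EuclideanSpace ℝ (Fin N)} (hu : ‖u‖ = 1)
    (hG : GoodL N (sL μ u)) {β b : ℝ} (hβ : 0 < β) (hb : 0 < b)
    (hfix : b = β * rat (sL μ u) b) :
    ∃ C > 0, ∀ n : ℕ, 1 ≤ n →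
      ∫ σ, (Xm β σ - b)^2 * gibbsWeight N n β σ ∂(Measure.pi fun _ : Fin n => μ) ≤
        C / n * ∫ σ, gibbsWeight N n β σ ∂(Measure.pi fun _ : Fin n => μ) := by
  set f := rat (sL μ u) with hf
  have hbβ : b ≤ β := by
    have := le_of_abs_le (hG.rat_bd b)
    rw [hfix]
    exact mul_le_of_le_one_right hβ.le this
  have h0 : sL μ u 0 0 = 1 := by simp [sL, mom]
  have hρ := hG.rho_gt hN hβ hb hfix h0
  set ρ := sL μ u 0 b * exp (-(b^2/(2*β))) with hρd
  set r := √ρ with hr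
  have hr1 : 1 < r := by rw [hr]; exact Real.lt_sqrt_of_sq_lt (by simpa using hρ)
  have hrr : r^2 = ρ := sq_sqrt (by linarith)
  have hlog : 0 < log r := log_pos hr1
  set ε := min (b/2) (√(2 * β * log r)) with hε
  have ε0 : 0 < ε := lt_min (by linarith) (by positivity)
  have εb : ε < b := (min_le_left _ _).trans_lt (by linarith)
  have εr : exp (ε^2 / (2*β)) ≤ r := by
    have : ε^2 ≤ 2 * β * log r := by
      calc ε^2 ≤ (√(2 * β * log r))^2 := by gcongr; exact min_le_right _ _
        _ = _ := sq_sqrt (by positivity)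
    rw [← exp_log (by linarith : 0 < r)]
    apply exp_le_exp.2
    rw [div_le_iff₀ (by positivity)]
    linarith
  obtain ⟨c, c0, hc⟩ := hG.q_lower hN hβ ε0 εb hbβ hfix
  refine ⟨(β^4 * (6 + 2 * β) + c * β^2 / (r - 1)) / c, ?_, fun n hn => ?_⟩
  · have : 0 < r - 1 := by linarith
    positivity
  have hn' : (0:ℝ) < n := by exact_mod_cast hn
  set P := Measure.pi fun _ : Fin n => μ with hP
  set Z := ∫ σ, gibbsWeight N n β σ ∂P with hZ
  have hZl : ρ^n ≤ Z := Z_lower hu hn hβ b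
  have hw0 : ∀ σ : Fin n → UnitSphere N, 0 < gibbsWeight N n β σ := fun σ => exp_pos _
  have cw := weight_cont (N := N) (n := n) β
  have cX := Xm_cont (N := N) (n := n) β
  have cf : Continuous f := hG.rat_cont
  -- pointwise
  have pt : ∀ σ : Fin n → UnitSphere N, c * ((Xm β σ - b)^2 * gibbsWeight N n β σ) ≤
      (∑ i, β^2 / n^2 * (Tm f β σ i * ((β / n * ‖Sm σ i‖)^2 - b^2) * gibbsWeight N n β σ)
        + β^4 * (6 + 2 * β) / n * gibbsWeight N n β σ) + c * β^2 * r^n := by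
    intro σ
    have hd := mul_le_mul_of_nonneg_right (drift_le hG hn hβ hb hbβ σ) (hw0 σ).le
    have e : (β^2 / n^2 * ∑ i, Tm (rat (sL μ u)) β σ i * ((β / n * ‖Sm σ i‖)^2 - b^2)
        + β^4 * (6 + 2 * β) / n) * gibbsWeight N n β σ =
        (∑ i, β^2 / n^2 * (Tm f β σ i * ((β / n * ‖Sm σ i‖)^2 - b^2) * gibbsWeight N n β σ)
        + β^4 * (6 + 2 * β) / n * gibbsWeight N n β σ) := by
      rw [add_mul, mul_assoc, Finset.sum_mul, Finset.mul_sum]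
    rw [e] at hd
    have X0 := Xm_nonneg hβ σ
    have X1 := Xm_le hn hβ σ
    rcases le_or_gt ε (Xm β σ) with hx | hx
    · have := mul_le_mul_of_nonneg_right (hc _ hx X1) (hw0 σ).le
      have : 0 ≤ c * β^2 * r^n := by positivity
      linarith
    · have h1 := mul_nonneg (hG.h_nonneg_small hN hβ X0 (hx.trans εb) hfix) (hw0 σ).le
      have h2 : (Xm β σ - b)^2 ≤ β^2 := by
        apply sq_le_sq'
        · linarith
        · linarith
      have h3 : gibbsWeight N n β σ ≤ r^n := by
        calc gibbsWeight N n β σ = exp (n * ((Xm β σ)^2 / (2 * β))) := by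
              rw [weight_eq, Xm]; congr 1; field_simp
          _ ≤ exp (n * (ε^2 / (2*β))) := by gcongr
          _ = (exp (ε^2 / (2*β)))^n := by rw [← exp_nat_mul]
          _ ≤ r^n := by gcongr
      have h4 : c * ((Xm β σ - b)^2 * gibbsWeight N n β σ) ≤ c * (β^2 * r^n) := by
        have := (hw0 σ).le
        gcongr
      linarith
  have cTi : ∀ i : Fin n, Continuous fun σ : Fin n → UnitSphere N =>
      β^2 / n^2 * (Tm f β σ i * ((β / n * ‖Sm σ i‖)^2 - b^2) * gibbsWeight N n β σ) := by
    intro i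
    have := Tm_cont (N := N) cf β i
    have := Sm_cont (N := N) i
    fun_prop
  have int := integral_mono (μ := P) (cont_int (by fun_prop)) (cont_int (by fun_prop)) pt
  rw [integral_const_mul, integral_add (cont_int (by fun_prop)) (cont_int (by fun_prop)),
    integral_add (cont_int (by fun_prop)) (cont_int (by fun_prop)),
    integral_finsetSum _ (fun i _ => cont_int (cTi i)), integral_const_mul] at int
  have z : ∀ i ∈ Finset.univ, ∫ σ : Fin n → UnitSphere N,
      β^2 / n^2 * (Tm f β σ i * ((β / n * ‖Sm σ i‖)^2 - b^2) * gibbsWeight N n β σ) ∂P = 0 := by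
    intro i _
    rw [integral_const_mul, orth hμinv hu hG β i (φ := fun v => (β / n * ‖v‖)^2 - b^2)
      (by fun_prop), mul_zero]
  rw [Finset.sum_eq_zero z, zero_add, ← hZ] at int
  simp only [integral_const, probReal_univ, one_smul] at int
  have hrn : r^n ≤ Z / ((r - 1) * n) := by
    have hr10 : 0 < r - 1 := by linarith
    rw [le_div_iff₀ (by positivity)]
    have b1 := one_add_mul_le_pow (by linarith : (-2:ℝ) ≤ r - 1) n
    have : (r - 1) * n ≤ r^n := by
      rw [show 1 + (r - 1) = r by ring] at b1; linarith
    calc r^n * ((r-1) * n) ≤ r^n * r^n := by gcongr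
      _ = ρ^n := by rw [← hrr]; ring
      _ ≤ Z := hZl
  have hr10 : 0 < r - 1 := by linarith
  have fin : c * ∫ σ, (Xm β σ - b)^2 * gibbsWeight N n β σ ∂P ≤
      c * ((β^4 * (6 + 2 * β) + c * β^2 / (r - 1)) / c / n * Z) := by
    refine int.trans ?_
    have : c * β^2 * r^n ≤ c * β^2 * (Z / ((r - 1) * n)) := by gcongr
    refine (add_le_add_right this _).trans (le_of_eq ?_)
    field_simp
  exact le_of_mul_le_mul_left fin c0

lemma R_bound {L : ℕ → ℝ → ℝ} (h : GoodL N L) (hN : 2 ≤ N) {n : ℕ} (hn : 1 ≤ n) {β b : ℝ}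
    (hβ : 0 < β) (hb : 0 < b) (hfix : b = β * rat L b) (σ : Fin n → UnitSphere N) {D : ℝ}
    (hD : D = (1 / (n:ℝ)) * (√n * (β^2 / ((n:ℝ)^2 * b^2)) * 2 * ∑ i, Tm (rat L) β σ i)) :
    |D / ((1 - β * rat' L b) / n) - Wspin N n β b σ| ≤
      √n * ((1 + 12 * β^2 / (1 - β * rat' L b)) / b^2) * (Xm β σ - b)^2 +
      (2 * β^2 * (2 + 2 * β) / (b^2 * (1 - β * rat' L b))) / √n := by
  have hn' : (0:ℝ) < n := by exact_mod_cast hn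
  have hp := h.hder_pos hN hβ hb hfix
  set d := 1 - β * rat' L b with hd
  set X := Xm β σ with hX
  have X0 : 0 ≤ X := Xm_nonneg hβ σ
  have X1 : X ≤ β := Xm_le hn hβ σ
  have hT := T_approx h hn hβ σ
  rw [← hX] at hT
  set T := ∑ i, Tm (rat L) β σ i with hTdef
  set e := T - n^2 / β^2 * (X * (X - β * rat L X)) with he
  have hδ := h.rat_taylor X b
  set δ := rat L X - rat L b - rat' L b * (X - b) with hδd
  have hsn : √(n:ℝ) * √n = n := mul_self_sqrt hn'.le
  have hs0 : 0 < √(n:ℝ) := by positivity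
  have hW : Wspin N n β b σ = √n * ((X^2 - b^2) / b^2) := by
    rw [Wspin, hX, Xm]; field_simp
  have hTe : T = n^2 / β^2 * (X * (X - β * rat L X)) + e := by rw [he]; ring
  have hh : X - β * rat L X = d * (X - b) - β * δ := by
    rw [hd, hδd]; linear_combination hfix
  have main : D / (d / n) - Wspin N n β b σ =
      √n * (((X - b)^2 - 2 * X * β * δ / d) / b^2) + (2 * β^2 * e / (b^2 * d)) * (√n / n^2) := by
    rw [hW, hD, hTe, hh]
    field_simp
    ring
  rw [main]
  refine (abs_add_le _ _).trans ?_
  refine add_le_add ?_ ?_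
  · rw [abs_mul, abs_of_pos hs0, abs_div, abs_of_pos (by positivity : 0 < b^2),
      mul_assoc (√(n:ℝ))]
    refine mul_le_mul_of_nonneg_left ?_ hs0.le
    rw [div_mul_eq_mul_div]
    refine div_le_div_of_nonneg_right ?_ (by positivity)
    refine (abs_sub _ _).trans ?_
    rw [abs_of_nonneg (sq_nonneg _), add_mul, one_mul]
    refine add_le_add le_rfl ?_
    rw [abs_div, abs_of_pos hp, div_mul_eq_mul_div]
    refine div_le_div_of_nonneg_right ?_ hp.le
    rw [abs_mul, abs_of_nonneg (by positivity : 0 ≤ 2 * X * β)]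
    calc 2 * X * β * |δ| ≤ 2 * β * β * (6 * (X - b)^2) := by gcongr
      _ = _ := by ring
  · rw [abs_mul, abs_of_pos (by positivity : 0 < √(n:ℝ) / (n:ℝ)^2), abs_div,
      abs_of_pos (by positivity : 0 < b^2 * d), abs_mul, abs_of_pos (by positivity : 0 < 2 * β^2)]
    have e2 : 2 * β^2 * |e| / (b^2 * d) * (√n / n^2) ≤
      2 * β^2 * (n * (2 + 2 * β)) / (b^2 * d) * (√n / n^2) := by gcongr
    refine e2.trans (le_of_eq ?_)
    have hsq : √(n:ℝ) / n^2 = 1 / (n * √n) := by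
      rw [div_eq_div_iff (by positivity) (by positivity)]
      linear_combination (n:ℝ) * hsn
    rw [hsq]
    field_simp

end final

/-- Approximate linear regression property: with `λ = (1 - β f'(b))/n`, the remainder
`R = D₁/λ - W_n` satisfies `E|R| ≤ C n^{-1/2}`. -/
theorem regression_remainder_bound (N : ℕ) (hN : 2 ≤ N)
    (μ : Measure (UnitSphere N)) [IsProbabilityMeasure μ]
    (hμinv : ∀ e : EuclideanSpace ℝ (Fin N) ≃ₗᵢ[ℝ] EuclideanSpace ℝ (Fin N),
      Measure.map (sphereMap e) μ = μ)
    (β : ℝ) (hβ : (N : ℝ) < β)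
    (b : ℝ) (hb : 0 < b) (hbfix : b = β * besselRatio N b) :
    ∃ C > 0, ∀ n : ℕ, 1 ≤ n →
      (∫ σ, |D1 N n β b μ σ / ((1 - β * deriv (besselRatio N) b) / n) - Wspin N n β b σ|
          ∂(gibbsMeasure N n β μ)) ≤ C / Real.sqrt n := by
  have hN' : (0:ℝ) < N := by exact_mod_cast (by omega : 0 < N)
  have hβ0 : 0 < β := hN'.trans hβ
  let i0 : Fin N := ⟨0, by omega⟩
  have hG := sL_good hN hμinv i0
  have hu : ‖(EuclideanSpace.single i0 1 : EuclideanSpace ℝ (Fin N))‖ = 1 := by simp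
  generalize (EuclideanSpace.single i0 1 : EuclideanSpace ℝ (Fin N)) = u at hG hu
  have hfix : b = β * rat (sL μ u) b := by rw [← bessel_eq_rat hG hN hb]; exact hbfix
  have hder : deriv (besselRatio N) b = rat' (sL μ u) b := by
    have : besselRatio N =ᶠ[nhds b] rat (sL μ u) := by
      filter_upwards [Ioi_mem_nhds hb] with x hx
      exact bessel_eq_rat hG hN hx
    rw [this.deriv_eq]
    exact (hG.rat_d b).deriv
  rw [hder]
  obtain ⟨C, C0, hC⟩ := conc hN hμinv hu hG hβ0 hb hfix
  have hp := hG.hder_pos hN hβ0 hb hfix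
  have hR := fun (n : ℕ) (hn : 1 ≤ n) (σ : Fin n → UnitSphere N) =>
    R_bound hG hN hn hβ0 hb hfix σ (D1_eq hμinv hu hG β b σ)
  set d := 1 - β * rat' (sL μ u) b with hd
  set K1 := (1 + 12 * β^2 / d) / b^2 with hK1
  set K2 := 2 * β^2 * (2 + 2 * β) / (b^2 * d) with hK2
  have K10 : 0 < K1 := by positivity
  have K20 : 0 < K2 := by positivity
  refine ⟨K1 * C + K2, by positivity, fun n hn => ?_⟩
  have hn' : (0:ℝ) < n := by exact_mod_cast hn
  have hs0 : 0 < √(n:ℝ) := by positivity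
  have hsn : √(n:ℝ) * √n = n := mul_self_sqrt hn'.le
  have hCn := hC n hn
  have cw := weight_cont (N := N) (n := n) β
  have cX := Xm_cont (N := N) (n := n) β
  have hw0 : ∀ σ : Fin n → UnitSphere N, 0 < gibbsWeight N n β σ := fun σ => exp_pos _
  have hZ0 : 0 < ∫ σ, gibbsWeight N n β σ ∂(Measure.pi fun _ : Fin n => μ) :=
    integral_exp_pos (cont_int cw)
  unfold gibbsMeasure
  set P := Measure.pi fun _ : Fin n => μ with hP
  set Z := ∫ σ, gibbsWeight N n β σ ∂P with hZ
  have hm : Measurable fun σ : Fin n → UnitSphere N => ENNReal.ofReal (gibbsWeight N n β σ / Z) :=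
    (cw.measurable.div_const Z).ennreal_ofReal
  rw [integral_withDensity_eq_integral_toReal_smul hm
    (Filter.Eventually.of_forall fun _ => ENNReal.ofReal_lt_top)]
  have bd : ∀ σ : Fin n → UnitSphere N,
      (ENNReal.ofReal (gibbsWeight N n β σ / Z)).toReal •
        |D1 N n β b μ σ / (d / n) - Wspin N n β b σ| ≤
      √n * K1 / Z * ((Xm β σ - b)^2 * gibbsWeight N n β σ) + K2 / √n / Z * gibbsWeight N n β σ := by
    intro σ
    rw [ENNReal.toReal_ofReal (div_nonneg (hw0 σ).le hZ0.le), smul_eq_mul]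
    refine (mul_le_mul_of_nonneg_left (hR n hn σ) (div_nonneg (hw0 σ).le hZ0.le)).trans
      (le_of_eq ?_)
    field_simp
  refine (integral_mono_of_nonneg (Filter.Eventually.of_forall fun σ => ?_)
    (cont_int (by fun_prop)) (Filter.Eventually.of_forall bd)).trans ?_
  · exact smul_nonneg ENNReal.toReal_nonneg (abs_nonneg _)
  rw [integral_add (cont_int (by fun_prop)) (cont_int (by fun_prop)), integral_const_mul,
    integral_const_mul, ← hZ]
  have h1 := mul_le_mul_of_nonneg_left hCn (by positivity : 0 ≤ √(n:ℝ) * K1 / Z)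
  refine (add_le_add_left h1 _).trans (le_of_eq ?_)
  have h2 : C / (n:ℝ) = C / (√n * √n) := by rw [hsn]
  rw [h2]
  field_simp

end
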